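/- Let (Ω, F, P) be a probability space and let A_1, …, A_n be independent events, each with P(A_i) = p for the same p ∈ [0,1]. Then P(A_1 ∪ ⋯ ∪ A_n) ≥ n·p / (1 + n·p). -/

import Mathlib

open MeasureTheory ProbabilityTheory

theorem one_sub_pow_le_one_div_one_add_mul {p : ℝ} (hp0 : 0 ≤ p) (hp1 : p ≤ 1) (n : ℕ) :
    (1 - p) ^ n ≤ 1 / (1 + n * p) := by
  rw [le_div_iff₀ (by positivity)]
  calc (1 - p) ^ n * (1 + n * p)
      ≤ (1 - p) ^ n * (1 + p) ^ n :=
        mul_le_mul_of_nonneg_left (one_add_mul_le_pow (by linarith) n)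
          (pow_nonneg (by linarith) n)
    _ = ((1 - p) * (1 + p)) ^ n := (mul_pow _ _ _).symm
    _ ≤ 1 := pow_le_one₀ (mul_nonneg (by linarith) (by linarith)) (by nlinarith)

theorem measure_iInter_compl_of_iIndepSet {Ω ι : Type*} [MeasurableSpace Ω] [Fintype ι]
    {P : Measure Ω} {A : ι → Set Ω} (hindep : iIndepSet A P) :
    P (⋂ i, (A i)ᶜ) = ∏ i, P (A i)ᶜ := by
  simpa using (iIndepSet_iff A P).1 hindep Finset.univ (f := fun i ↦ (A i)ᶜ)
    fun i _ ↦ (MeasurableSpace.measurableSet_generateFrom (Set.mem_singleton (A i))).compl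

/-- If `A 1, …, A n` are independent events each of probability `p`, then the probability of
their union is at least `n*p / (1 + n*p)`. -/
theorem measure_iUnion_ge_of_iIndepSet
    {Ω : Type*} [MeasurableSpace Ω] (P : Measure Ω) [IsProbabilityMeasure P]
    (n : ℕ) (A : Fin n → Set Ω) (hmeas : ∀ i, MeasurableSet (A i))
    (hindep : iIndepSet A P)
    (p : ℝ) (hp0 : 0 ≤ p) (hp1 : p ≤ 1)
    (hprob : ∀ i, P (A i) = ENNReal.ofReal p) :
    ENNReal.ofReal ((n : ℝ) * p / (1 + n * p)) ≤ P (⋃ i, A i) := by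
  have hcompl (i : Fin n) : P (A i)ᶜ = ENNReal.ofReal (1 - p) := by
    rw [prob_compl_eq_one_sub (hmeas i), hprob, ENNReal.ofReal_sub _ hp0, ENNReal.ofReal_one]
  have hinter : P (⋃ i, A i)ᶜ = ENNReal.ofReal ((1 - p) ^ n) := by
    rw [Set.compl_iUnion, measure_iInter_compl_of_iIndepSet hindep]
    simp [hcompl, ENNReal.ofReal_pow (sub_nonneg.2 hp1)]
  have hunion : P (⋃ i, A i) = ENNReal.ofReal (1 - (1 - p) ^ n) := by
    rw [← compl_compl (⋃ i, A i), prob_compl_eq_one_sub (MeasurableSet.iUnion hmeas).compl,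
      hinter, ENNReal.ofReal_sub _ (pow_nonneg (sub_nonneg.2 hp1) n), ENNReal.ofReal_one]
  rw [hunion]
  apply ENNReal.ofReal_le_ofReal
  have hsum : (n : ℝ) * p / (1 + n * p) = 1 - 1 / (1 + n * p) := by
    have : (1 : ℝ) + n * p ≠ 0 := by positivity
    field_simp
    ring
  rw [hsum]
  linarith [one_sub_pow_le_one_div_one_add_mul hp0 hp1 n]
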